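/- arXiv:2304.07564 — 2 statements merged into one kernel-verified Lean document; each statement's English description precedes it below -/
import Mathlib

section
/- Let V be a type, L a simplicial complex on V (a set of finsets of V closed under taking subsets), and φ : V ≃ V a bijection; let M := {φ(σ) | σ ∈ L} be the image complex (which is again closed under subsets). Fix S ⊆ V and write L_S := {σ ∈ L | ↑σ ⊆ S} and M_S := {τ ∈ M | ↑τ ⊆ S}. If φ maps the vertex set of L_S onto the vertex set of M_S, i.e. φ '' {v ∈ V | {v} ∈ L_S} = {v ∈ V | {v} ∈ M_S}, then φ maps L_S onto M_S, i.e. {φ(σ) | σ ∈ L_S} = M_S. In particular L_S and M_S are isomorphic simplicial complexes. -/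
/-- Criterion for a bijection to map an induced subcomplex onto another: let `L` be a
simplicial complex on `V`, `φ : V ≃ V`, and `M` the image complex of `L` under `φ`.
If `φ` maps the vertex set of `L_S = {σ ∈ L | ↑σ ⊆ S}` onto the vertex set of
`M_S = {τ ∈ M | ↑τ ⊆ S}`, then `φ` maps `L_S` onto `M_S`. -/
theorem image_induced_of_vertex_image {V : Type*} [DecidableEq V]
    (L : Set (Finset V)) (hL : ∀ σ ∈ L, ∀ τ ⊆ σ, τ ∈ L)
    (φ : V ≃ V) (S : Set V)
    (hvert : φ '' {v : V | ({v} : Finset V) ∈ {σ ∈ L | (↑σ : Set V) ⊆ S}}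
      = {v : V | ({v} : Finset V) ∈
          {τ ∈ (fun σ : Finset V => σ.image φ) '' L | (↑τ : Set V) ⊆ S}}) :
    (fun σ : Finset V => σ.image φ) '' {σ ∈ L | (↑σ : Set V) ⊆ S}
      = {τ ∈ (fun σ : Finset V => σ.image φ) '' L | (↑τ : Set V) ⊆ S} := by
  have mem_iff : ∀ σ ∈ L, ∀ v ∈ σ, (v ∈ S ↔ φ v ∈ S) := by
    intro σ hσ v hv
    have hvL : ({v} : Finset V) ∈ L := hL σ hσ _ (Finset.singleton_subset_iff.2 hv)
    have hφvM : ({φ v} : Finset V) ∈ (fun σ : Finset V => σ.image φ) '' L :=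
      ⟨{v}, hvL, Finset.image_singleton _ _⟩
    have h := Set.ext_iff.1 hvert (φ v)
    rw [φ.injective.mem_set_image] at h
    simpa only [Set.mem_ofPred_eq, hvL, hφvM, true_and, Finset.coe_singleton,
      Set.singleton_subset_iff] using h
  have subset_iff : ∀ σ ∈ L, ((σ : Set V) ⊆ S ↔ ((σ.image φ : Finset V) : Set V) ⊆ S) := by
    intro σ hσ
    rw [Finset.coe_image, Set.image_subset_iff]
    exact forall₂_congr (mem_iff σ hσ)
  ext τ
  constructor
  · rintro ⟨σ, ⟨hσ, hσS⟩, rfl⟩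
    exact ⟨⟨σ, hσ, rfl⟩, (subset_iff σ hσ).1 hσS⟩
  · rintro ⟨⟨σ, hσ, rfl⟩, hσS⟩
    exact ⟨σ, ⟨hσ, (subset_iff σ hσ).2 hσS⟩, rfl⟩
end

section
/- Let V be a decidable-equality type and K a simplicial complex on V (a set of finsets of V closed under taking subsets). Let W ⊆ V be a set of vertices that are pairwise non-adjacent in K, i.e. for all distinct u, w ∈ W one has {u, w} ∉ K. Fix w ∈ W and define the deletion K − A := {σ \ A | σ ∈ K} for a set A ⊆ V (σ \ A meaning the finset obtained by removing the elements of A). Then the link of w in K − (W \ {w}) equals the link of w in K: {σ ∈ K − (W \ {w}) | w ∉ σ ∧ σ ∪ {w} ∈ K − (W \ {w})} = {σ ∈ K | w ∉ σ ∧ σ ∪ {w} ∈ K}. -/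
open Classical in
/-- The finset `σ \ A` obtained from a finset `σ` by removing the elements of a set `A`. -/
noncomputable def Finset.sdiffSet {V : Type*} (σ : Finset V) (A : Set V) : Finset V :=
  σ.filter (fun x => x ∉ A)

open Classical in
/-- In a subset-closed family `K`, the faces of the deletion `K − A` are the faces of `K`
that avoid `A`. -/
theorem mem_image_sdiffSet_iff {V : Type*} {K : Set (Finset V)}
    (hK : ∀ σ ∈ K, ∀ τ ⊆ σ, τ ∈ K) (A : Set V) (τ : Finset V) :
    τ ∈ (fun σ : Finset V => σ.sdiffSet A) '' K ↔ τ ∈ K ∧ ∀ x ∈ τ, x ∉ A := by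
  constructor
  · rintro ⟨σ, hσ, rfl⟩
    exact ⟨hK σ hσ _ (Finset.filter_subset _ _), fun x hx => (Finset.mem_filter.mp hx).2⟩
  · rintro ⟨hτ, h⟩
    exact ⟨τ, hτ, Finset.filter_true_of_mem h⟩

/-- If `W` is a set of pairwise non-adjacent vertices of a simplicial complex `K` and
`w ∈ W`, then the link of `w` in the deletion `K − (W \ {w})` equals the link of `w`
in `K`. -/
theorem link_deletion_pairwise_nonadjacent {V : Type*} [DecidableEq V]
    (K : Set (Finset V)) (hK : ∀ σ ∈ K, ∀ τ ⊆ σ, τ ∈ K)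
    (W : Set V) (hW : ∀ u ∈ W, ∀ w ∈ W, u ≠ w → ({u, w} : Finset V) ∉ K)
    (w : V) (hw : w ∈ W) :
    {σ ∈ (fun σ : Finset V => σ.sdiffSet (W \ {w})) '' K |
        w ∉ σ ∧ insert w σ ∈ (fun σ : Finset V => σ.sdiffSet (W \ {w})) '' K}
      = {σ ∈ K | w ∉ σ ∧ insert w σ ∈ K} := by
  ext σ
  simp only [Set.mem_ofPred_eq, mem_image_sdiffSet_iff hK]
  constructor
  · rintro ⟨⟨hσ, -⟩, hwσ, hins, -⟩
    exact ⟨hσ, hwσ, hins⟩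
  · rintro ⟨hσ, hwσ, hins⟩
    have avoid : ∀ x ∈ insert w σ, x ∉ W \ {w} := by
      rintro x hx ⟨hxW, hxw⟩
      refine hW x hxW w hw hxw (hK _ hins _ ?_)
      exact Finset.insert_subset hx (Finset.singleton_subset_iff.mpr (Finset.mem_insert_self w σ))
    exact ⟨⟨hσ, fun x hx => avoid x (Finset.mem_insert_of_mem hx)⟩, hwσ, hins, avoid⟩
end
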